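/- arXiv:2108.09414 — 2 statements merged into one kernel-verified Lean document; each statement's English description precedes it below -/
import Mathlib

section
/- For every integer n ≥ 1, the number m_{1,2}(n) of partitions of n with odd mex is odd if and only if n = m(3m+1) or n = m(3m−1) for some positive integer m. -/
/-- The mex of a partition: the smallest positive integer that is not a part. -/
noncomputable def partMex {n : ℕ} (P : Nat.Partition n) : ℕ :=
  sInf {k : ℕ | 0 < k ∧ k ∉ P.parts}

open PowerSeries Filter Finset
open scoped PowerSeries.WithPiTopology Topology

/-- Finite form of Gauss's identity for the sum of `q ^ (k * (k + 1) / 2)`, due to Shanks. -/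
theorem shanks_identity {R : Type*} [CommRing R] (q : R) (n : ℕ) :
    (∏ k ∈ range n, (1 - q ^ (2 * k + 1))) * ∑ k ∈ range (2 * n), q ^ (k * (k + 1) / 2) =
      ∑ s ∈ range n, (∏ k ∈ Ico s n, (1 - q ^ (2 * k + 2))) *
        (∏ k ∈ range s, (1 - q ^ (2 * k + 1))) * q ^ (s * (2 * n + 1)) := by
  have telescope (n m : ℕ) (hm : m ≤ n) :
      ∑ s ∈ range m, ((∏ k ∈ Ico s (n + 1), (1 - q ^ (2 * k + 2))) *
        (∏ k ∈ range s, (1 - q ^ (2 * k + 1))) * q ^ (s * (2 * (n + 1) + 1)) -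
        (1 - q ^ (2 * n + 1)) * ((∏ k ∈ Ico s n, (1 - q ^ (2 * k + 2))) *
        (∏ k ∈ range s, (1 - q ^ (2 * k + 1))) * q ^ (s * (2 * n + 1)))) =
      (∏ k ∈ Ico m n, (1 - q ^ (2 * k + 2))) * (∏ k ∈ range m, (1 - q ^ (2 * k + 1))) *
        (1 - q ^ (2 * m)) * q ^ (m * (2 * n + 1)) := by
    induction m with
    | zero => simp
    | succ m ih =>
      rw [sum_range_succ, ih (by omega), prod_Ico_succ_top (by omega),
        prod_eq_prod_Ico_succ_bot (show m < n by omega), prod_range_succ]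
      ring
  induction n with
  | zero => simp
  | succ n ih =>
    have h := telescope n n le_rfl
    rw [sum_sub_distrib, ← mul_sum, ← ih] at h
    have h₁ : (2 * n) * (2 * n + 1) / 2 = n * (2 * n + 1) := by
      rw [mul_assoc, Nat.mul_div_cancel_left _ two_pos]
    have h₂ : (2 * n + 1) * (2 * n + 1 + 1) / 2 = (n + 1) * (2 * n + 1) := by
      rw [show (2 * n + 1) * (2 * n + 1 + 1) = 2 * ((n + 1) * (2 * n + 1)) by ring,
        Nat.mul_div_cancel_left _ two_pos]
    rw [sum_range_succ _ n, eq_add_of_sub_eq h, show 2 * (n + 1) = 2 * n + 1 + 1 by ring,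
      sum_range_succ, sum_range_succ, h₁, h₂, prod_range_succ]
    simp only [Ico_self, prod_empty, Nat.Ico_succ_singleton, prod_singleton]
    ring

theorem genFun_one_mul_pentagonalSeries (R : Type*) [CommRing R] [TopologicalSpace R]
    [IsTopologicalRing R] [T2Space R] :
    Nat.Partition.genFun (fun _ _ ↦ (1 : R)) * pentagonalSeries R = 1 := by
  have h := (Nat.Partition.hasProd_genFun (fun _ _ ↦ (1 : R))).mul
    (WithPiTopology.hasProd_one_sub_X_pow R)
  have h_one (i : ℕ) : (1 + ∑' j, (1 : R) • (X : R⟦X⟧) ^ ((i + 1) * (j + 1))) *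
      (1 - X ^ (i + 1)) = 1 := by
    have hX : constantCoeff ((X : R⟦X⟧) ^ (i + 1)) = 0 := by simp
    have h_geom := WithPiTopology.tsum_pow_mul_one_sub_of_constantCoeff_eq_zero hX
    rw [(WithPiTopology.summable_pow_of_constantCoeff_eq_zero hX).tsum_eq_zero_add] at h_geom
    simpa only [one_smul, pow_mul, pow_zero] using h_geom
  simp_rw [h_one] at h
  exact h.unique hasProd_one

theorem summable_X_pow_of_strictMono (R : Type*) [CommRing R] [TopologicalSpace R] {f : ℕ → ℕ}
    (hf : StrictMono f) : Summable fun k ↦ (X : R⟦X⟧) ^ f k := by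
  nontriviality R using Subsingleton.eq_zero (α := R⟦X⟧)
  apply WithPiTopology.summable_of_tendsto_order_atTop_nhds_top
  simp_rw [order_X_pow]
  exact ENat.tendsto_natCast_nhds_top.comp hf.tendsto_atTop

theorem strictMono_triangle : StrictMono fun k : ℕ ↦ k * (k + 1) / 2 := by
  refine strictMono_nat_of_lt_succ fun k ↦ ?_
  have : (k + 1) * (k + 1 + 1) = k * (k + 1) + 2 * (k + 1) := by ring
  grind

theorem prod_one_sub_pow_even_mul_odd {R : Type*} [CommRing R] (q : R) (n : ℕ) :
    (∏ k ∈ range n, (1 - q ^ (2 * k + 2))) * ∏ k ∈ range n, (1 - q ^ (2 * k + 1)) =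
      ∏ k ∈ range (2 * n), (1 - q ^ (k + 1)) := by
  induction n with
  | zero => simp
  | succ n ih =>
    rw [show 2 * (n + 1) = 2 * n + 1 + 1 by ring, prod_range_succ, prod_range_succ,
      prod_range_succ, prod_range_succ, ← ih]
    ring

theorem shanks_identity_char_two {R : Type*} [CommRing R] [CharP R 2] (q : R) (n : ℕ) :
    ∃ r, (∏ k ∈ range (2 * n), (1 - q ^ (k + 1))) * ∑ k ∈ range (2 * n), q ^ (k * (k + 1) / 2) =
      (∏ k ∈ range n, (1 - q ^ (k + 1))) ^ 4 + q ^ n * r := by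
  have h_sq : ∏ k ∈ range n, (1 - q ^ (2 * k + 2)) = (∏ k ∈ range n, (1 - q ^ (k + 1))) ^ 2 := by
    rw [← prod_pow]
    refine prod_congr rfl fun k _ ↦ ?_
    rw [sub_pow_char, one_pow, ← pow_mul]
    ring_nf
  rcases n with _ | n
  · exact ⟨-1, by simp⟩
  rw [← prod_one_sub_pow_even_mul_odd, mul_assoc, shanks_identity, sum_range_succ',
    ← range_eq_Ico, h_sq]
  have h_dvd : q ^ (n + 1) ∣ ∑ s ∈ range n, (∏ k ∈ Ico (s + 1) (n + 1), (1 - q ^ (2 * k + 2))) *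
      (∏ k ∈ range (s + 1), (1 - q ^ (2 * k + 1))) * q ^ ((s + 1) * (2 * (n + 1) + 1)) :=
    dvd_sum fun s _ ↦ dvd_mul_of_dvd_right (pow_dvd_pow _ (by nlinarith)) _
  obtain ⟨r, hr⟩ := h_dvd
  refine ⟨(∏ k ∈ range (n + 1), (1 - q ^ (k + 1))) ^ 2 * r, ?_⟩
  rw [hr]
  simp
  ring

theorem tendsto_X_pow_mul_zero {R : Type*} [CommRing R] [TopologicalSpace R] (r : ℕ → R⟦X⟧) :
    Tendsto (fun n ↦ X ^ n * r n) atTop (𝓝 0) := by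
  rw [WithPiTopology.tendsto_iff_coeff_tendsto]
  refine fun d ↦ tendsto_atTop_of_eventually_const (i₀ := d + 1) fun n hn ↦ ?_
  rw [coeff_X_pow_mul', if_neg (by omega), map_zero]

theorem pentagonalSeries_mul_tsum (R : Type*) [CommRing R] [CharP R 2] [TopologicalSpace R]
    [IsTopologicalRing R] [T2Space R] :
    pentagonalSeries R * ∑' k : ℕ, X ^ (k * (k + 1) / 2) = pentagonalSeries R ^ 4 := by
  have : CharP R⟦X⟧ 2 := charP_of_injective_algebraMap (C_injective (R := R)) 2
  have h_prod := (WithPiTopology.hasProd_one_sub_X_pow R).tendsto_prod_nat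
  have h_sum := (summable_X_pow_of_strictMono R strictMono_triangle).hasSum.tendsto_sum_nat
  have h_two : Tendsto (fun n : ℕ ↦ 2 * n) atTop atTop :=
    tendsto_id.const_mul_atTop' two_pos
  choose r hr using shanks_identity_char_two (X : R⟦X⟧)
  refine tendsto_nhds_unique ((h_prod.comp h_two).mul (h_sum.comp h_two)) ?_
  simpa [Function.comp_def, hr] using (h_prod.pow 4).add (tendsto_X_pow_mul_zero r)

theorem tsum_mul_genFun_one (R : Type*) [CommRing R] [CharP R 2] [TopologicalSpace R]
    [IsTopologicalRing R] [T2Space R] :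
    (∑' k : ℕ, X ^ (k * (k + 1) / 2)) * Nat.Partition.genFun (fun _ _ ↦ (1 : R)) =
      pentagonalSeries R ^ 2 := by
  linear_combination
    Nat.Partition.genFun (fun _ _ ↦ (1 : R)) ^ 2 * pentagonalSeries_mul_tsum R -
    ((∑' k : ℕ, X ^ (k * (k + 1) / 2)) * Nat.Partition.genFun (fun _ _ ↦ (1 : R)) -
      pentagonalSeries R ^ 2 * (Nat.Partition.genFun (fun _ _ ↦ (1 : R)) * pentagonalSeries R + 1))
      * genFun_one_mul_pentagonalSeries R

theorem coeff_pentagonalSeries_sq (n : ℕ) :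
    (pentagonalSeries (ZMod 2) ^ 2).coeff n ≠ 0 ↔ ∃ k : ℤ, n = 2 * pentagonal k := by
  have h : pentagonalSeries (ZMod 2) ^ 2 = expand 2 two_ne_zero (pentagonalSeries (ZMod 2)) := by
    have := MvPowerSeries.map_frobenius_expand 2 two_ne_zero (f := pentagonalSeries (ZMod 2))
    rw [ZMod.frobenius_zmod, MvPowerSeries.map_id] at this
    exact this.symm
  rw [h, coeff_expand]
  split_ifs with hn
  · obtain ⟨m, rfl⟩ := hn
    rw [Nat.mul_div_cancel_left _ two_pos, ne_eq, coeff_pentagonalSeries_eq_zero_iff, not_not]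
    simp [Set.mem_range, eq_comm]
  · simp only [ne_eq, not_true_eq_false, false_iff]
    rintro ⟨k, rfl⟩
    simp at hn

theorem exists_eq_two_mul_pentagonal_iff {n : ℕ} (hn : 1 ≤ n) :
    (∃ k : ℤ, n = 2 * pentagonal k) ↔
      ∃ m : ℕ, 0 < m ∧ (n = m * (3 * m + 1) ∨ n = m * (3 * m - 1)) := by
  have h_pos (m : ℕ) (hm : 0 < m) : 2 * pentagonal m = m * (3 * m - 1) := by
    zify [show 1 ≤ 3 * m by omega]
    exact two_mul_natCast_pentagonal m
  have h_neg (m : ℕ) : 2 * pentagonal (-m) = m * (3 * m + 1) := by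
    zify
    exact two_mul_natCast_pentagonal_neg m
  constructor
  · rintro ⟨k, rfl⟩
    have hk : k ≠ 0 := by rintro rfl; simp [pentagonal_def] at hn
    refine ⟨k.natAbs, by omega, ?_⟩
    rw [← h_pos _ (by omega), ← h_neg]
    rcases Int.natAbs_eq k with h | h
    · exact .inr (by rw [← h])
    · exact .inl (by rw [← h])
  · rintro ⟨m, hm, rfl | rfl⟩
    · exact ⟨-m, (h_neg m).symm⟩
    · exact ⟨m, (h_pos m hm).symm⟩

/-- Partitions of `n` containing the parts `s` correspond to partitions of `n - s.sum`. -/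
def partitionWithPartsEquiv {n : ℕ} (s : Multiset ℕ) (hs : ∀ i ∈ s, 0 < i) (hn : s.sum ≤ n) :
    {P : Nat.Partition n // s ≤ P.parts} ≃ Nat.Partition (n - s.sum) where
  toFun P := ⟨P.1.parts - s, fun hi ↦ P.1.parts_pos (Multiset.mem_of_le tsub_le_self hi), by
    have h := congrArg Multiset.sum (tsub_add_cancel_of_le P.2)
    rw [Multiset.sum_add, P.1.parts_sum] at h
    omega⟩
  invFun Q := ⟨⟨Q.parts + s, fun hi ↦ (Multiset.mem_add.mp hi).elim Q.parts_pos (hs _), by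
    rw [Multiset.sum_add, Q.parts_sum]
    omega⟩, Multiset.le_add_left _ _⟩
  left_inv P := Subtype.ext (Nat.Partition.ext (tsub_add_cancel_of_le P.2))
  right_inv Q := Nat.Partition.ext (add_tsub_cancel_right _ _)

theorem card_partition_Icc_subset (n k : ℕ) :
    Nat.card {P : Nat.Partition n // ∀ i ∈ Icc 1 k, i ∈ P.parts} =
      if k * (k + 1) / 2 ≤ n then Fintype.card (Nat.Partition (n - k * (k + 1) / 2)) else 0 := by
  have h_sum : (Icc 1 k).val.sum = k * (k + 1) / 2 := by
    refine (Nat.div_eq_of_eq_mul_left two_pos ?_).symm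
    rw [sum_val]
    induction k with
    | zero => rfl
    | succ k ih =>
      rw [sum_Icc_succ_top (by omega), add_mul (Finset.sum _ _), ← ih]
      simp only [id]
      ring
  have h_iff (P : Nat.Partition n) : (∀ i ∈ Icc 1 k, i ∈ P.parts) ↔ (Icc 1 k).val ≤ P.parts := by
    rw [Multiset.le_iff_subset (Icc 1 k).nodup]
    rfl
  simp_rw [h_iff]
  split_ifs with h
  · rw [← h_sum] at h ⊢
    rw [Nat.card_congr (partitionWithPartsEquiv _ (by simp; omega) h), Nat.card_eq_fintype_card]
  · rw [Nat.card_eq_zero]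
    refine .inl ⟨fun ⟨P, hP⟩ ↦ h ?_⟩
    rw [← h_sum, ← P.parts_sum]
    obtain ⟨t, ht⟩ := Multiset.le_iff_exists_add.mp hP
    rw [ht, Multiset.sum_add]
    exact Nat.le_add_right _ _

theorem partMex_spec {n : ℕ} (P : Nat.Partition n) :
    IsLeast {k : ℕ | 0 < k ∧ k ∉ P.parts} (partMex P) := by
  have h : {k : ℕ | 0 < k ∧ k ∉ P.parts}.Nonempty :=
    ⟨n + 1, by simp, fun h ↦ by simpa using Nat.Partition.le_of_mem_parts h⟩
  exact ⟨Nat.sInf_mem h, fun k hk ↦ Nat.sInf_le hk⟩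

theorem lt_partMex_iff {n k : ℕ} (P : Nat.Partition n) :
    k < partMex P ↔ ∀ i ∈ Icc 1 k, i ∈ P.parts := by
  obtain ⟨⟨h_pos, h_notMem⟩, h_le⟩ := partMex_spec P
  constructor
  · intro h i hi
    by_contra hP
    rw [mem_Icc] at hi
    have := h_le ⟨by omega, hP⟩
    omega
  · intro h
    by_contra hk
    exact h_notMem (h _ (mem_Icc.mpr (by omega)))

theorem partMex_le {n : ℕ} (P : Nat.Partition n) : partMex P ≤ n + 1 :=
  (partMex_spec P).2 ⟨by simp, fun h ↦ by simpa using Nat.Partition.le_of_mem_parts h⟩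

theorem sum_partMex_eq_coeff (R : Type*) [CommRing R] {n N : ℕ} (hN : n < N) :
    ((∑ P : Nat.Partition n, partMex P : ℕ) : R) =
      ((∑ k ∈ range N, X ^ (k * (k + 1) / 2)) *
        Nat.Partition.genFun (fun _ _ ↦ (1 : R))).coeff n := by
  classical
  have h (P : Nat.Partition n) : partMex P = ∑ k ∈ range N, if k < partMex P then 1 else 0 := by
    have := partMex_le P
    rw [← card_filter, show {k ∈ range N | k < partMex P} = range (partMex P) by grind, card_range]
  rw [sum_congr rfl fun P _ ↦ h P, sum_comm, sum_mul, map_sum, Nat.cast_sum]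
  refine sum_congr rfl fun k _ ↦ ?_
  simp_rw [lt_partMex_iff]
  rw [← card_filter, ← Fintype.card_subtype, ← Nat.card_eq_fintype_card,
    card_partition_Icc_subset, coeff_X_pow_mul']
  split_ifs <;> simp [Finsupp.prod]

theorem odd_sum_partMex_iff (n : ℕ) :
    Odd (∑ P : Nat.Partition n, partMex P) ↔ (pentagonalSeries (ZMod 2) ^ 2).coeff n ≠ 0 := by
  have h := (summable_X_pow_of_strictMono (ZMod 2) strictMono_triangle).hasSum.tendsto_sum_nat
    |>.mul_const (Nat.Partition.genFun (fun _ _ ↦ (1 : ZMod 2)))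
  rw [tsum_mul_genFun_one, WithPiTopology.tendsto_iff_coeff_tendsto] at h
  have h_eq : ((∑ P : Nat.Partition n, partMex P : ℕ) : ZMod 2) =
      (pentagonalSeries (ZMod 2) ^ 2).coeff n :=
    tendsto_nhds_unique (tendsto_atTop_of_eventually_const (i₀ := n + 1)
      fun N hN ↦ (sum_partMex_eq_coeff (ZMod 2) hN).symm) (h n)
  rw [← h_eq, ZMod.natCast_ne_zero_iff_odd]

/-- The number of partitions of `n` with odd mex is odd exactly when `n = m(3m+1)` or
`n = m(3m-1)` for some positive integer `m`. -/
theorem stmt_14 (n : ℕ) (hn : 1 ≤ n) :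
    Odd (Nat.card {P : Nat.Partition n // Odd (partMex P)}) ↔
      ∃ m : ℕ, 0 < m ∧ (n = m * (3 * m + 1) ∨ n = m * (3 * m - 1)) := by
  rw [← exists_eq_two_mul_pentagonal_iff hn, ← coeff_pentagonalSeries_sq, ← odd_sum_partMex_iff,
    odd_sum_iff_odd_card_odd, Nat.card_eq_fintype_card, Fintype.card_subtype]
end

section
/- For every integer k ≥ 0 and n = 2k+1 odd, the following four quantities are equal: the number of partitions of n with mex ≡ 1 (mod 4); the number of partitions of n with mex ≡ 3 (mod 4); the number of partitions of n with odd mex and an odd number of parts; and the number of partitions of n with odd mex and an even number of parts. -/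
open Finset PowerSeries

/-- A finite form of Gauss's identity for the triangular numbers (Shanks). -/
theorem sum_range_pow_triangle_eq {A : Type*} [CommRing A] (x : A) (d : ℕ → A)
    (hd : ∀ i, d i * (1 - x ^ (2 * i + 1)) = 1) (n : ℕ) :
    ∑ j ∈ range (2 * n), x ^ (j * (j + 1) / 2) =
      ∑ s ∈ range n, (∏ i ∈ Ico s n, (1 - x ^ (2 * i + 2)) * d i) * x ^ (s * (2 * n + 1)) := by
  induction n with
  | zero => simp
  | succ n ih =>
    have telescope : ∀ m ≤ n,
        ∑ s ∈ range m,
            (∏ i ∈ Ico s (n + 1), (1 - x ^ (2 * i + 2)) * d i) * x ^ (s * (2 * (n + 1) + 1)) =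
          ∑ s ∈ range m, (∏ i ∈ Ico s n, (1 - x ^ (2 * i + 2)) * d i) * x ^ (s * (2 * n + 1)) +
          (∏ i ∈ Ico m n, (1 - x ^ (2 * i + 2)) * d i) * d n * x ^ (m * (2 * n + 1)) *
            (1 - x ^ (2 * m)) := by
      intro m hm
      induction m with
      | zero => simp
      | succ m ihm =>
        rw [sum_range_succ, sum_range_succ, ihm (by lia), prod_Ico_succ_top (by lia : m ≤ n),
          prod_eq_prod_Ico_succ_bot (by lia : m < n)]
        generalize ∏ i ∈ Ico (m + 1) n, (1 - x ^ (2 * i + 2)) * d i = R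
        have hm := hd m
        have hn := hd n
        have e : x ^ (m * (2 * (n + 1) + 1)) = x ^ (m * (2 * n + 1)) * x ^ (2 * m) := by ring
        have e' : x ^ ((m + 1) * (2 * n + 1)) = x ^ (m * (2 * n + 1)) * x ^ (2 * n + 1) := by ring
        have e1 : x ^ (2 * n + 2) = x ^ (2 * n + 1) * x := by ring
        have e2 : x ^ (2 * m + 2) = x ^ (2 * m) * x ^ 2 := by ring
        have e3 : x ^ (2 * (m + 1)) = x ^ (2 * m) * x ^ 2 := by ring
        have e4 : x ^ (2 * m + 1) = x ^ (2 * m) * x := by ring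
        rw [e4] at hm
        rw [e, e', e1, e2, e3]
        generalize x ^ (m * (2 * n + 1)) = p at *
        generalize x ^ (2 * n + 1) = q at *
        generalize x ^ (2 * m) = r at *
        linear_combination (R * p * (1 - r * x ^ 2) * d m) * hn +
          (R * p * d n * q * (1 - r * x ^ 2)) * hm
    rw [show 2 * (n + 1) = 2 * n + 1 + 1 by ring, sum_range_succ, sum_range_succ, ih,
      sum_range_succ, show 2 * n + 1 + 1 + 1 = 2 * (n + 1) + 1 by ring, telescope n le_rfl]
    have h1 : 2 * n * (2 * n + 1) / 2 = n * (2 * n + 1) := by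
      rw [mul_assoc]; simp
    have h2 : (2 * n + 1) * (2 * n + 1 + 1) / 2 = n * (2 * n + 1) + (2 * n + 1) := by
      rw [show (2 * n + 1) * (2 * n + 1 + 1) = 2 * (n * (2 * n + 1) + (2 * n + 1)) by ring]; simp
    rw [h1, h2]
    have hn := hd n
    simp only [Ico_self, prod_empty, Nat.Ico_succ_singleton, prod_singleton]
    have e : x ^ (n * (2 * (n + 1) + 1)) = x ^ (n * (2 * n + 1)) * x ^ (2 * n) := by ring
    have e1 : x ^ (2 * n + 2) = x ^ (2 * n) * x ^ 2 := by ring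
    have e2 : x ^ (2 * n + 1) = x ^ (2 * n) * x := by ring
    rw [pow_add, e, e1, e2]
    rw [e2] at hn
    generalize x ^ (n * (2 * n + 1)) = p at *
    generalize x ^ (2 * n) = r at *
    linear_combination (-(p * (1 + r * x))) * hn

/-- Gauss's identity for the triangular numbers, up to terms of high order. -/
theorem X_pow_dvd_sum_X_pow_triangle_mul_prod_sub (n : ℕ) :
    (X : ℚ⟦X⟧) ^ (2 * n) ∣
      (∑ j ∈ range (2 * n), X ^ (j * (j + 1) / 2)) * ∏ i ∈ range n, (1 - X ^ (2 * i + 1)) -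
        ∏ i ∈ range n, (1 - X ^ (2 * i + 2)) := by
  have hd : ∀ i, (1 - X ^ (2 * i + 1) : ℚ⟦X⟧)⁻¹ * (1 - X ^ (2 * i + 1)) = 1 := fun i ↦
    PowerSeries.inv_mul_cancel _ (by simp)
  rw [sum_range_pow_triangle_eq X _ hd]
  rcases n with _ | n
  · simp
  rw [sum_range_succ', add_mul, add_sub_assoc]
  refine dvd_add (Dvd.dvd.mul_right (dvd_sum fun s _ ↦ Dvd.dvd.mul_left
    (pow_dvd_pow _ (by nlinarith)) _) _) ?_
  rw [zero_mul, pow_zero, mul_one, ← range_eq_Ico, ← prod_mul_distrib,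
    prod_congr rfl fun i _ ↦ by rw [mul_assoc, hd, mul_one], sub_self]
  exact dvd_zero _

/-- The generating function of partitions weighted multiplicatively by their parts, multiplied by
finitely many factors of its inverse, up to terms of high order. -/
theorem eventually_X_pow_dvd_genFun_mul_prod_sub_one (t : ℕ → ℚ) (m : ℕ) :
    ∀ᶠ N in Filter.atTop, X ^ m ∣ Nat.Partition.genFun (fun i c ↦ t i ^ c) *
      ∏ i ∈ range N, (1 - C (t (i + 1)) * X ^ (i + 1)) - 1 := by
  let _ : TopologicalSpace ℚ := ⊥
  have _ : DiscreteTopology ℚ := ⟨rfl⟩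
  open scoped PowerSeries.WithPiTopology in
  have h := (Nat.Partition.hasProd_genFun (fun i c ↦ t i ^ c)).tendsto_prod_nat
  rw [WithPiTopology.tendsto_iff_coeff_tendsto] at h
  simp only [nhds_discrete, Filter.tendsto_pure] at h
  have h' : ∀ᶠ N in Filter.atTop, ∀ d ∈ range m, _ :=
    (Filter.eventually_all_finset (range m)).2 fun d _ ↦ h d
  filter_upwards [h'] with N hN
  have hu : ∀ i, (1 + ∑' j, t (i + 1) ^ (j + 1) • (X : ℚ⟦X⟧) ^ ((i + 1) * (j + 1))) *
      (1 - C (t (i + 1)) * X ^ (i + 1)) = 1 := by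
    intro i
    have h0 : (C (t (i + 1)) * X ^ (i + 1) : ℚ⟦X⟧).constantCoeff = 0 := by simp
    refine Eq.trans ?_ (WithPiTopology.tsum_pow_mul_one_sub_of_constantCoeff_eq_zero h0)
    congr 1
    have hs := WithPiTopology.summable_pow_of_constantCoeff_eq_zero h0
    rw [hs.tsum_eq_zero_add, pow_zero]
    congr 2 with j : 2
    rw [smul_eq_C_mul, mul_pow, ← pow_mul, map_pow]
  have hprod : (∏ i ∈ range N,
      (1 + ∑' j, t (i + 1) ^ (j + 1) • (X : ℚ⟦X⟧) ^ ((i + 1) * (j + 1)))) *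
      ∏ i ∈ range N, (1 - C (t (i + 1)) * X ^ (i + 1)) = 1 := by
    rw [← prod_mul_distrib]
    exact prod_eq_one fun i _ ↦ hu i
  nth_rw 2 [← hprod]
  rw [← sub_mul]
  refine Dvd.dvd.mul_right (X_pow_dvd_iff.2 fun d hd ↦ ?_) _
  rw [map_sub, hN d (mem_range.2 hd), sub_self]

theorem coeff_eq_zero_of_X_pow_dvd_mul_sub {n : ℕ} (hn : Odd n) {F D E : ℚ⟦X⟧}
    (hD : rescale (-1) D = D) (hE : rescale (-1) E = E) (hD0 : IsUnit D)
    (h : X ^ (n + 1) ∣ F * D - E) : coeff n F = 0 := by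
  have h' : X ^ (n + 1) ∣ rescale (-1) F * D - E := by
    have := map_dvd (rescale (-1 : ℚ)) h
    rw [map_pow, rescale_neg_one_X, map_sub, map_mul, hD, hE, neg_pow] at this
    exact dvd_of_mul_left_dvd this
  have h2 := dvd_sub h h'
  rw [sub_sub_sub_cancel_right, ← sub_mul, hD0.dvd_mul_right] at h2
  have := X_pow_dvd_iff.1 h2 n (by lia)
  rw [map_sub, coeff_rescale, hn.neg_one_pow] at this
  linarith

theorem eventually_coeff_sum_X_pow_triangle_mul_genFun (t : ℕ → ℚ) (ht : ∀ i, t (2 * i + 1) = -1)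
    {n : ℕ} (hn : Odd n) :
    ∀ᶠ N in Filter.atTop, coeff n ((∑ j ∈ range (2 * N), X ^ (j * (j + 1) / 2)) *
      Nat.Partition.genFun (fun i c ↦ t i ^ c)) = 0 := by
  have h2 : Filter.Tendsto (fun N : ℕ ↦ 2 * N) Filter.atTop Filter.atTop :=
    Filter.tendsto_id.const_mul_atTop' (by lia)
  filter_upwards [h2.eventually (eventually_X_pow_dvd_genFun_mul_prod_sub_one t (n + 1)),
    Filter.eventually_ge_atTop n] with N hW hN
  have hn0 := hn.pos
  have hG := (pow_dvd_pow (X : ℚ⟦X⟧) (by lia : n + 1 ≤ 2 * N)).trans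
    (X_pow_dvd_sum_X_pow_triangle_mul_prod_sub N)
  have hsplit : ∀ M : ℕ, ∏ i ∈ range (2 * M), (1 - C (t (i + 1)) * X ^ (i + 1) : ℚ⟦X⟧) =
      ∏ i ∈ range M, ((1 + X ^ (2 * i + 1)) * (1 - C (t (2 * i + 2)) * X ^ (2 * i + 2))) := by
    intro M
    induction M with
    | zero => simp
    | succ M ih =>
      rw [show 2 * (M + 1) = 2 * M + 1 + 1 by ring, prod_range_succ, prod_range_succ, ih,
        prod_range_succ, ht, map_neg, map_one, mul_assoc]
      ring
  rw [hsplit] at hW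
  set ψ : ℚ⟦X⟧ := ∑ j ∈ range (2 * N), X ^ (j * (j + 1) / 2)
  set W := Nat.Partition.genFun (fun i c ↦ t i ^ c)
  set Q : ℚ⟦X⟧ :=
    ∏ i ∈ range N, ((1 + X ^ (2 * i + 1)) * (1 - C (t (2 * i + 2)) * X ^ (2 * i + 2)))
  set B : ℚ⟦X⟧ := ∏ i ∈ range N, (1 - X ^ (2 * i + 1))
  set A : ℚ⟦X⟧ := ∏ i ∈ range N, (1 - X ^ (2 * i + 2))
  have hodd : ∀ i, (-X : ℚ⟦X⟧) ^ (2 * i + 1) = - X ^ (2 * i + 1) := fun i ↦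
    Odd.neg_pow ⟨i, rfl⟩ _
  have heven : ∀ i, (-X : ℚ⟦X⟧) ^ (2 * i + 2) = X ^ (2 * i + 2) := fun i ↦
    Even.neg_pow ⟨i + 1, by ring⟩ _
  have rescale_C : ∀ a : ℚ, rescale (-1) (C a) = C a := fun a ↦ by
    ext i
    rw [coeff_rescale, coeff_C]
    split_ifs with hi <;> simp [hi]
  refine coeff_eq_zero_of_X_pow_dvd_mul_sub (D := B * Q) (E := A) hn ?_ ?_ ?_ ?_
  · simp only [B, Q, ← prod_mul_distrib, map_prod]
    refine prod_congr rfl fun i _ ↦ ?_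
    simp only [map_mul, map_sub, map_add, map_one, map_pow, rescale_neg_one_X, hodd, heven,
      rescale_C]
    ring
  · simp only [A, map_prod, map_sub, map_one, map_pow, rescale_neg_one_X, heven]
  · rw [isUnit_iff_constantCoeff]
    simp [B, Q, map_prod]
  · rw [show ψ * W * (B * Q) - A = (ψ * B) * (W * Q - 1) + (ψ * B - A) by ring]
    exact dvd_add (hW.mul_left _) hG

theorem partMex_mem {n : ℕ} (P : n.Partition) : 0 < partMex P ∧ partMex P ∉ P.parts :=
  Nat.sInf_mem (s := {k : ℕ | 0 < k ∧ k ∉ P.parts})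
    ⟨n + 1, n.succ_pos, fun h ↦ absurd (Nat.Partition.le_of_mem_parts h) (by lia)⟩

theorem lt_partMex_iff_s15 {n : ℕ} (P : n.Partition) (j : ℕ) :
    j < partMex P ↔ (Icc 1 j).val ≤ P.parts := by
  rw [Multiset.le_iff_subset (Icc 1 j).nodup]
  constructor
  · intro h a ha
    rw [mem_val, mem_Icc] at ha
    by_contra hP
    have := Nat.sInf_le (s := {k : ℕ | 0 < k ∧ k ∉ P.parts}) ⟨ha.1, hP⟩
    exact absurd (show partMex P ≤ a from this) (by lia)
  · intro h
    by_contra! hj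
    exact (partMex_mem P).2 (h (by simpa using ⟨(partMex_mem P).1, hj⟩))

theorem partMex_le_succ {n : ℕ} (P : n.Partition) : partMex P ≤ n + 1 :=
  Nat.sInf_le (s := {k : ℕ | 0 < k ∧ k ∉ P.parts})
    ⟨n.succ_pos, fun h ↦ absurd (Nat.Partition.le_of_mem_parts h) (by lia)⟩

theorem sum_Icc_one_val (j : ℕ) : (Icc 1 j).val.sum = j * (j + 1) / 2 := by
  have h : (Icc 1 j).val.sum = ∑ i ∈ range (j + 1), i := by
    rw [sum_range_succ', range_eq_Ico, sum_Ico_add' (fun i ↦ i)]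
    exact Finset.sum_val (Icc 1 j)
  rw [h, sum_range_id, mul_comm, Nat.add_sub_cancel]

theorem prod_map_pow_left {M : Type*} [CommMonoid M] (x : M) (s : Multiset ℕ) :
    (s.map (x ^ ·)).prod = x ^ s.sum := by
  induction s using Multiset.induction with
  | empty => simp
  | cons a s ih => simp [ih, pow_add]

/-- Add the parts `1, …, j` to a partition. -/
def addInitial {n j : ℕ} (Q : (n - (Icc 1 j).val.sum).Partition) (hj : (Icc 1 j).val.sum ≤ n) :
    n.Partition where
  parts := (Icc 1 j).val + Q.parts
  parts_pos {a} ha := by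
    rcases Multiset.mem_add.1 ha with h | h
    · exact (mem_Icc.1 (Finset.mem_def.2 h)).1
    · exact Q.parts_pos h
  parts_sum := by
    rw [Multiset.sum_add, Q.parts_sum]
    lia

theorem coeff_genFun_pow_eq_sum_prod_map (t : ℕ → ℚ) (n : ℕ) :
    coeff n (Nat.Partition.genFun (fun i c ↦ t i ^ c)) =
      ∑ P : n.Partition, (P.parts.map t).prod := by
  simp [Finset.prod_multiset_map_count, Finsupp.prod]

theorem sum_ite_lt_partMex (t : ℕ → ℚ) (ht : ∀ i, t i * t i = 1) (n j : ℕ) :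
    ∑ P : n.Partition,
        (if j < partMex P then (P.parts.map t).prod * ∏ a ∈ Icc 1 j, t a else 0) =
      coeff n (X ^ (j * (j + 1) / 2) * Nat.Partition.genFun (fun i c ↦ t i ^ c)) := by
  rw [coeff_X_pow_mul', ← sum_Icc_one_val, ← sum_filter]
  split_ifs with hj
  · rw [coeff_genFun_pow_eq_sum_prod_map]
    refine (sum_bij (fun Q _ ↦ addInitial Q hj) ?_ ?_ ?_ ?_).symm
    · intro Q _
      simp [lt_partMex_iff_s15, addInitial]
    · intro Q _ Q' _ h
      ext1
      simpa [addInitial] using congrArg Nat.Partition.parts h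
    · intro P hP
      rw [mem_filter, lt_partMex_iff_s15] at hP
      obtain ⟨s, hs⟩ := Multiset.le_iff_exists_add.1 hP.2
      refine ⟨⟨s, fun {a} ha ↦ P.parts_pos (by rw [hs]; exact Multiset.mem_add.2 (Or.inr ha)), ?_⟩,
        mem_univ _, ?_⟩
      · have := P.parts_sum
        rw [hs, Multiset.sum_add] at this
        lia
      · ext1
        exact hs.symm
    · intro Q _
      have : (∏ a ∈ Icc 1 j, t a) * ∏ a ∈ Icc 1 j, t a = 1 := by
        rw [← prod_mul_distrib]
        exact prod_eq_one fun a _ ↦ ht a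
      rw [addInitial, Multiset.map_add, Multiset.prod_add]
      change _ = (∏ a ∈ Icc 1 j, t a) * _ * _
      linear_combination (-(Q.parts.map t).prod) * this
  · refine sum_eq_zero fun P hP ↦ (hj ?_).elim
    rw [mem_filter, lt_partMex_iff_s15] at hP
    obtain ⟨s, hs⟩ := Multiset.le_iff_exists_add.1 hP.2
    have := P.parts_sum
    rw [hs, Multiset.sum_add] at this
    lia

theorem sum_prod_map_mul_sum_range_partMex_eq_zero (t : ℕ → ℚ) (ht : ∀ i, t i * t i = 1)
    (ht' : ∀ i, t (2 * i + 1) = -1) {n : ℕ} (hn : Odd n) :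
    ∑ P : n.Partition,
      (P.parts.map t).prod * ∑ j ∈ range (partMex P), ∏ a ∈ Icc 1 j, t a = 0 := by
  obtain ⟨N, hN, hnN⟩ := ((eventually_coeff_sum_X_pow_triangle_mul_genFun t ht' hn).and
    (Filter.eventually_ge_atTop n)).exists
  rw [← hN, sum_mul, map_sum]
  simp_rw [← sum_ite_lt_partMex t ht]
  rw [sum_comm]
  refine sum_congr rfl fun P _ ↦ ?_
  have hn0 := hn.pos
  have := partMex_le_succ P
  rw [mul_sum, ← sum_filter]
  congr 1
  ext j
  simp only [mem_range, mem_filter]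
  lia

theorem sum_range_prod_neg_one (m : ℕ) :
    ∑ j ∈ range m, ∏ _a ∈ Icc 1 j, (-1 : ℚ) = if Odd m then 1 else 0 := by
  induction m with
  | zero => simp
  | succ m ih =>
    rw [sum_range_succ, ih]
    rcases Nat.even_or_odd m with h | h <;> simp [h, Nat.odd_add_one]

theorem prod_Icc_neg_one_pow (m : ℕ) :
    ∏ a ∈ Icc 1 m, (-1 : ℚ) ^ a = if m % 4 = 0 ∨ m % 4 = 3 then 1 else -1 := by
  induction m with
  | zero => simp
  | succ m ih =>
    rw [prod_Icc_succ_top (by lia), ih, neg_one_pow_eq_ite]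
    have : m % 4 < 4 := Nat.mod_lt _ (by lia)
    have h2 : Even (m + 1) ↔ m % 4 = 1 ∨ m % 4 = 3 := by grind
    simp only [h2]
    interval_cases h : m % 4 <;> simp [Nat.add_mod, h]

theorem sum_range_prod_neg_one_pow (m : ℕ) :
    ∑ j ∈ range m, ∏ a ∈ Icc 1 j, (-1 : ℚ) ^ a =
      (if m % 4 = 1 then 1 else 0) - (if m % 4 = 3 then 1 else 0) := by
  induction m with
  | zero => simp
  | succ m ih =>
    rw [sum_range_succ, ih, prod_Icc_neg_one_pow]
    have : m % 4 < 4 := Nat.mod_lt _ (by lia)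
    interval_cases h : m % 4 <;> simp [Nat.add_mod, h]

theorem card_partMex_mod_four {n : ℕ} (hn : Odd n) :
    Nat.card {P : n.Partition // partMex P % 4 = 1} =
      Nat.card {P : n.Partition // partMex P % 4 = 3} := by
  have h := sum_prod_map_mul_sum_range_partMex_eq_zero (fun a ↦ (-1) ^ a)
    (fun i ↦ by rw [← mul_pow]; simp) (fun i ↦ Odd.neg_one_pow ⟨i, rfl⟩) hn
  have hw : ∀ P : n.Partition, (P.parts.map fun a ↦ (-1 : ℚ) ^ a).prod = -1 := fun P ↦ by
    rw [prod_map_pow_left, P.parts_sum, hn.neg_one_pow]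
  simp_rw [sum_range_prod_neg_one_pow, hw] at h
  rw [← mul_sum, sum_sub_distrib, sum_boole, sum_boole] at h
  simp only [Nat.card_eq_fintype_card, Fintype.card_subtype]
  have h' : (#{P : n.Partition | partMex P % 4 = 1} : ℚ) =
      #{P : n.Partition | partMex P % 4 = 3} := by linarith
  exact_mod_cast h'

theorem card_odd_partMex_parity {n : ℕ} (hn : Odd n) :
    Nat.card {P : n.Partition // Odd (partMex P) ∧ Odd (Multiset.card P.parts)} =
      Nat.card {P : n.Partition // Odd (partMex P) ∧ Even (Multiset.card P.parts)} := by
  have h := sum_prod_map_mul_sum_range_partMex_eq_zero (fun _ ↦ -1)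
    (fun i ↦ by simp) (fun i ↦ rfl) hn
  have hw : ∀ P : n.Partition, (P.parts.map fun _ ↦ (-1 : ℚ)).prod *
      (if Odd (partMex P) then 1 else 0) =
      (if Odd (partMex P) ∧ Even (Multiset.card P.parts) then 1 else 0) -
      (if Odd (partMex P) ∧ Odd (Multiset.card P.parts) then 1 else 0) := fun P ↦ by
    simp only [← Nat.not_even_iff_odd (n := Multiset.card P.parts)]
    by_cases h : Even (Multiset.card P.parts) <;> by_cases h' : Odd (partMex P) <;>
      simp [h, h', neg_one_pow_eq_ite]
  simp_rw [sum_range_prod_neg_one, hw] at h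
  rw [sum_sub_distrib, sum_boole, sum_boole] at h
  simp only [Nat.card_eq_fintype_card, Fintype.card_subtype]
  have h' : (#{P : n.Partition | Odd (partMex P) ∧ Odd (Multiset.card P.parts)} : ℚ) =
      #{P : n.Partition | Odd (partMex P) ∧ Even (Multiset.card P.parts)} := by linarith
  exact_mod_cast h'

theorem card_partMex_mod_four_add (n : ℕ) :
    Nat.card {P : n.Partition // partMex P % 4 = 1} +
      Nat.card {P : n.Partition // partMex P % 4 = 3} =
    Nat.card {P : n.Partition // Odd (partMex P) ∧ Odd (Multiset.card P.parts)} +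
      Nat.card {P : n.Partition // Odd (partMex P) ∧ Even (Multiset.card P.parts)} := by
  simp only [Nat.card_eq_fintype_card, Fintype.card_subtype, card_filter, ← sum_add_distrib]
  refine sum_congr rfl fun P _ ↦ ?_
  have h : Odd (partMex P) ↔ partMex P % 4 = 1 ∨ partMex P % 4 = 3 := by grind
  have h' := Nat.not_odd_iff_even (n := Multiset.card P.parts)
  grind

/-- For odd `n = 2k+1`, the following are all equal: the number of partitions of `n` with
mex `≡ 1 (mod 4)`; with mex `≡ 3 (mod 4)`; with odd mex and an odd number of parts; and
with odd mex and an even number of parts. -/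
theorem stmt_15 (k : ℕ) :
    Nat.card {P : Nat.Partition (2 * k + 1) // partMex P % 4 = 1} =
      Nat.card {P : Nat.Partition (2 * k + 1) // partMex P % 4 = 3} ∧
    Nat.card {P : Nat.Partition (2 * k + 1) // partMex P % 4 = 3} =
      Nat.card {P : Nat.Partition (2 * k + 1) //
        Odd (partMex P) ∧ Odd (Multiset.card P.parts)} ∧
    Nat.card {P : Nat.Partition (2 * k + 1) //
        Odd (partMex P) ∧ Odd (Multiset.card P.parts)} =
      Nat.card {P : Nat.Partition (2 * k + 1) //
        Odd (partMex P) ∧ Even (Multiset.card P.parts)} := by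
  have hn : Odd (2 * k + 1) := ⟨k, rfl⟩
  have h1 := card_partMex_mod_four hn
  have h2 := card_odd_partMex_parity hn
  have h3 := card_partMex_mod_four_add (2 * k + 1)
  lia
end
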